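/- Let d ≥ 2, L_0 ≥ 1, n ≥ 0, and let γ be a *-connected path in ℤ^d. If x ∈ 𝓛_n = L_n ℤ^d is such that the range {γ} intersects both S(x, L_n − 1) and S(x, 2L_n), then there exists a proper embedding 𝒯 ∈ Λ_{n,x} such that for every 0 ≤ k ≤ n and every m ∈ T_{(k)}, the range {γ} intersects both S(𝒯(m), L_{n−k} − 1) and S(𝒯(m), 2L_{n−k}). -/

import Mathlib

/-- The ℓ∞-norm on `ℤ^d`. -/
def linf {d : ℕ} (x : Fin d → ℤ) : ℤ := ((Finset.univ.sup fun i => (x i).natAbs : ℕ) : ℤ)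

/-- The ℓ∞-sphere `S(x,R)` in `ℤ^d`. -/
def sphereZ {d : ℕ} (x : Fin d → ℤ) (R : ℤ) : Set (Fin d → ℤ) := {y | linf (y - x) = R}

/-- The lattice `L ℤ^d`. -/
def lattice (d : ℕ) (L : ℤ) : Set (Fin d → ℤ) := {x | ∀ i, L ∣ x i}

/-- The scales `L_j = L_0 · 6^j`. -/
def Ln (L0 : ℤ) (j : ℕ) : ℤ := L0 * 6 ^ j

/-- Vertices of the dyadic tree `T_n`: sequences over `{1,2}` (here `Bool`)
of length at most `n`; the length is the depth of the vertex. -/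
def TreeVert (n : ℕ) := {l : List Bool // l.length ≤ n}

/-- `𝒯` is a proper embedding of `T_n` into `ℤ^d` with root at `x`:
(1) the root is mapped to `x`; (2) a vertex at depth `k` is mapped into `𝓛_{n-k}`;
(3) for a vertex `m` at depth `k < n`, its first child (append `false`) is at
ℓ∞-distance `L_{n-k}` from `m` and its second child (append `true`) is at
ℓ∞-distance `2 L_{n-k}` from `m`. -/
def ProperEmbedding (d n : ℕ) (L0 : ℤ) (x : Fin d → ℤ)
    (T : TreeVert n → (Fin d → ℤ)) : Prop :=
  T ⟨[], by simp⟩ = x ∧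
  (∀ (l : List Bool) (h : l.length ≤ n),
    T ⟨l, h⟩ ∈ lattice d (Ln L0 (n - l.length))) ∧
  (∀ (l : List Bool) (h : l.length < n),
    linf (T ⟨l ++ [false], by simpa using h⟩ - T ⟨l, h.le⟩) = Ln L0 (n - l.length) ∧
    linf (T ⟨l ++ [true], by simpa using h⟩ - T ⟨l, h.le⟩) = 2 * Ln L0 (n - l.length))

/-- `Λ_{n,x}`, the set of proper embeddings of `T_n` with root at `x`. -/
def Lambda (d n : ℕ) (L0 : ℤ) (x : Fin d → ℤ) : Set (TreeVert n → (Fin d → ℤ)) :=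
  {T | ProperEmbedding d n L0 x T}

/-- `γ : {0,…,l} → ℤ^d` is a `*`-connected path. -/
def StarPath {d : ℕ} (γ : ℕ → Fin d → ℤ) (l : ℕ) : Prop :=
  ∀ i, 1 ≤ i → i ≤ l → linf (γ i - γ (i - 1)) = 1

/-- The range `{γ}` of the path `γ : {0,…,l} → ℤ^d`. -/
def pathRange {d : ℕ} (γ : ℕ → Fin d → ℤ) (l : ℕ) : Set (Fin d → ℤ) :=
  γ '' {i | i ≤ l}

theorem linf_le_iff {d : ℕ} {x : Fin d → ℤ} {R : ℤ} (hR : 0 ≤ R) :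
    linf x ≤ R ↔ ∀ i, |x i| ≤ R := by
  lift R to ℕ using hR
  simp only [linf, Nat.cast_le, Finset.sup_le_iff, Finset.mem_univ, true_implies]
  exact forall_congr' fun i => by rw [Int.abs_eq_natAbs, Nat.cast_le]

theorem linf_nonneg {d : ℕ} (x : Fin d → ℤ) : 0 ≤ linf x := Int.natCast_nonneg _

theorem abs_apply_le_linf {d : ℕ} (x : Fin d → ℤ) (i : Fin d) : |x i| ≤ linf x :=
  (linf_le_iff (linf_nonneg x)).1 le_rfl i

theorem linf_add_le {d : ℕ} (x y : Fin d → ℤ) : linf (x + y) ≤ linf x + linf y :=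
  (linf_le_iff (add_nonneg (linf_nonneg x) (linf_nonneg y))).2 fun i =>
    (abs_add_le _ _).trans (add_le_add (abs_apply_le_linf x i) (abs_apply_le_linf y i))

theorem linf_neg {d : ℕ} (x : Fin d → ℤ) : linf (-x) = linf x := by
  simp [linf]

theorem linf_sub_comm {d : ℕ} (x y : Fin d → ℤ) : linf (x - y) = linf (y - x) := by
  rw [← linf_neg, neg_sub]

theorem linf_sub_le {d : ℕ} (x y z : Fin d → ℤ) :
    linf (x - z) ≤ linf (x - y) + linf (y - z) := by
  simpa using linf_add_le (x - y) (y - z)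

theorem exists_abs_apply_eq_linf {d : ℕ} {x : Fin d → ℤ} (hx : 0 < linf x) :
    ∃ i, |x i| = linf x := by
  by_contra! h
  have : linf x ≤ linf x - 1 := (linf_le_iff (by omega)).2 fun i => by
    have := abs_apply_le_linf x i
    have := h i
    omega
  omega

/-- A sequence of integers with increments at most one attains every intermediate value. -/
theorem exists_eq_of_unit_steps {f : ℕ → ℤ} {l : ℕ}
    (hf : ∀ i < l, |f (i + 1) - f i| ≤ 1) {a b : ℕ} (ha : a ≤ l) (hb : b ≤ l) {R : ℤ}
    (haR : f a ≤ R) (hbR : R ≤ f b) : ∃ c ≤ l, f c = R := by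
  by_contra! h
  have key : ∀ i ≤ l, f i < R ↔ f 0 < R := by
    intro i hi
    induction i with
    | zero => rfl
    | succ i ih =>
      rw [← ih (by omega)]
      have h1 := abs_le.1 (hf i hi)
      have h2 := h i (by omega)
      have h3 := h (i + 1) hi
      omega
  have h1 := key a ha
  have h2 := key b hb
  have h3 := h a ha
  omega

theorem StarPath.inter_sphereZ_nonempty {d : ℕ} {γ : ℕ → Fin d → ℤ} {l : ℕ}
    (hγ : StarPath γ l) {y p q : Fin d → ℤ} (hp : p ∈ pathRange γ l) (hq : q ∈ pathRange γ l)
    {R : ℤ} (hpR : linf (p - y) ≤ R) (hqR : R ≤ linf (q - y)) :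
    (pathRange γ l ∩ sphereZ y R).Nonempty := by
  obtain ⟨a, ha, rfl⟩ := hp
  obtain ⟨b, hb, rfl⟩ := hq
  obtain ⟨c, hc, h⟩ := exists_eq_of_unit_steps (f := fun i => linf (γ i - y)) (l := l)
    (fun i hi => by
      have h1 : linf (γ (i + 1) - γ i) = 1 := hγ (i + 1) (by omega) hi
      have h2 := linf_sub_le (γ (i + 1)) (γ i) y
      have h3 := linf_sub_le (γ i) (γ (i + 1)) y
      rw [linf_sub_comm (γ i) (γ (i + 1))] at h3
      rw [abs_le]
      constructor <;> linarith) ha hb hpR hqR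
  exact ⟨γ c, ⟨c, hc, rfl⟩, h⟩

/-- Rounding a point of a sphere of radius divisible by `M` to the lattice `M ℤ^d`. -/
theorem exists_lattice_near_of_linf_eq {d : ℕ} {M R : ℤ} (hM : 0 < M) (hR : 0 < R) (hMR : M ∣ R)
    {x z : Fin d → ℤ} (hx : x ∈ lattice d M) (hz : linf (z - x) = R) :
    ∃ y ∈ lattice d M, linf (y - x) = R ∧ linf (z - y) ≤ M - 1 := by
  refine ⟨fun i => z i - (z i - x i) % M, fun i => ?_, le_antisymm ?_ ?_, ?_⟩
  · have h : z i - (z i - x i) % M = x i + M * ((z i - x i) / M) := by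
      have := Int.mul_ediv_add_emod (z i - x i) M
      linarith
    change M ∣ z i - (z i - x i) % M
    exact h ▸ dvd_add (hx i) (dvd_mul_right _ _)
  · refine (linf_le_iff hR.le).2 fun i => ?_
    have h1 := abs_le.1 (hz ▸ abs_apply_le_linf (z - x) i)
    have h2 := Int.mul_ediv_add_emod (z i - x i) M
    have h3 := Int.emod_nonneg (z i - x i) hM.ne'
    have h4 : M * (-(R / M)) ≤ M * ((z i - x i) / M) := by
      refine mul_le_mul_of_nonneg_left ?_ hM.le
      rw [Int.le_ediv_iff_mul_le hM, neg_mul, Int.ediv_mul_cancel hMR]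
      exact h1.1
    rw [mul_neg, Int.mul_ediv_cancel' hMR] at h4
    simp only [Pi.sub_apply] at h1 ⊢
    rw [abs_le]
    constructor <;> linarith
  · obtain ⟨i, hi⟩ := exists_abs_apply_eq_linf (hz ▸ hR)
    have hdvd : M ∣ z i - x i := (dvd_abs _ _).1 (by rw [← Pi.sub_apply, hi, hz]; exact hMR)
    refine le_trans (le_of_eq ?_) (abs_apply_le_linf _ i)
    rw [← hz, ← hi]
    simp [Int.emod_eq_zero_of_dvd hdvd]
  · refine (linf_le_iff (by omega)).2 fun i => ?_
    have h3 := Int.emod_nonneg (z i - x i) hM.ne'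
    have h4 := Int.emod_lt_of_pos (z i - x i) hM
    simp only [Pi.sub_apply, sub_sub_cancel]
    rw [abs_le]
    constructor <;> linarith

theorem Ln_succ (L0 : ℤ) (j : ℕ) : Ln L0 (j + 1) = 6 * Ln L0 j := by
  simp only [Ln, pow_succ]
  ring

theorem Ln_pos {L0 : ℤ} (hL0 : 1 ≤ L0) (j : ℕ) : 0 < Ln L0 j := by
  unfold Ln
  positivity

/-- The point `x` of `𝓛_j` is such that `γ` meets `S(x, L_j - 1)` and `S(x, 2 L_j)`. -/
def CrossedAt {d : ℕ} (γ : ℕ → Fin d → ℤ) (l : ℕ) (L0 : ℤ) (j : ℕ) (x : Fin d → ℤ) : Prop :=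
  x ∈ lattice d (Ln L0 j) ∧
  (pathRange γ l ∩ sphereZ x (Ln L0 j - 1)).Nonempty ∧
  (pathRange γ l ∩ sphereZ x (2 * Ln L0 j)).Nonempty

/-- The ratio of the distance between a vertex and its child to the current scale. -/
def childRatio (b : Bool) : ℤ := if b then 2 else 1

theorem CrossedAt.exists_child {d : ℕ} {γ : ℕ → Fin d → ℤ} {l : ℕ} (hγ : StarPath γ l) {L0 : ℤ}
    (hL0 : 1 ≤ L0) {j : ℕ} {x : Fin d → ℤ} (hx : CrossedAt γ l L0 (j + 1) x) (b : Bool) :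
    ∃ y, CrossedAt γ l L0 j y ∧ linf (y - x) = childRatio b * Ln L0 (j + 1) := by
  obtain ⟨hxL, ⟨p, hp, hpx⟩, ⟨q, hq, hqx⟩⟩ := hx
  change linf (p - x) = _ at hpx
  change linf (q - x) = _ at hqx
  have hM := Ln_pos hL0 j
  rw [Ln_succ] at hpx hqx hxL ⊢
  set M := Ln L0 j
  have hxM : x ∈ lattice d M := fun i => (dvd_mul_left M 6).trans (hxL i)
  obtain ⟨z, hz, hzx⟩ : (pathRange γ l ∩ sphereZ x (childRatio b * (6 * M))).Nonempty := by
    apply hγ.inter_sphereZ_nonempty hp hq <;> cases b <;> simp [childRatio] <;> linarith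
  obtain ⟨y, hyM, hyx, hzy⟩ := exists_lattice_near_of_linf_eq hM
    (by cases b <;> simp [childRatio] <;> linarith)
    ((dvd_mul_left M 6).mul_left _) hxM hzx
  obtain ⟨w, hw, hwy⟩ : ∃ w ∈ pathRange γ l, 2 * M ≤ linf (w - y) := by
    cases b
    · refine ⟨q, hq, ?_⟩
      have := linf_sub_le q y x
      simp only [childRatio] at hyx
      norm_num at hyx
      linarith
    · refine ⟨p, hp, ?_⟩
      have := linf_sub_le y p x
      rw [linf_sub_comm y p] at this
      simp only [childRatio] at hyx
      norm_num at hyx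
      linarith
  exact ⟨y, ⟨hyM, hγ.inter_sphereZ_nonempty hz hw hzy (by linarith),
    hγ.inter_sphereZ_nonempty hz hw (by linarith) hwy⟩, hyx⟩

/-- The tree map, on reversed addresses, obtained from a root `x` at height `n` by iterating a
child map. -/
def iterateChild {α : Type*} (child : Bool → ℕ → α → α) (n : ℕ) (x : α) : List Bool → α
  | [] => x
  | b :: m => child b (n - m.length - 1) (iterateChild child n x m)

/-- if a `*`-connected path `γ` in `ℤ^d`, `d ≥ 2`, meets both
`S(x, L_n - 1)` and `S(x, 2 L_n)` for some `x ∈ 𝓛_n`, then there is a proper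
embedding `𝒯 ∈ Λ_{n,x}` such that for every `0 ≤ k ≤ n` and every vertex
`m ∈ T_{(k)}` (i.e. `m` of length `k ≤ n`), the range `{γ}` meets both
`S(𝒯(m), L_{n-k} - 1)` and `S(𝒯(m), 2 L_{n-k})`. -/
theorem path_crossing_on_all_scales (d : ℕ) (hd : 2 ≤ d)
    (L0 : ℤ) (hL0 : 1 ≤ L0) (n : ℕ)
    (γ : ℕ → Fin d → ℤ) (l : ℕ) (hγ : StarPath γ l)
    (x : Fin d → ℤ) (hx : x ∈ lattice d (Ln L0 n))
    (h1 : (pathRange γ l ∩ sphereZ x (Ln L0 n - 1)).Nonempty)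
    (h2 : (pathRange γ l ∩ sphereZ x (2 * Ln L0 n)).Nonempty) :
    ∃ T ∈ Lambda d n L0 x, ∀ (m : List Bool) (h : m.length ≤ n),
      (pathRange γ l ∩ sphereZ (T ⟨m, h⟩) (Ln L0 (n - m.length) - 1)).Nonempty ∧
      (pathRange γ l ∩ sphereZ (T ⟨m, h⟩) (2 * Ln L0 (n - m.length))).Nonempty := by
  have hchild : ∀ (b : Bool) (j : ℕ) (y : Fin d → ℤ), ∃ z, CrossedAt γ l L0 (j + 1) y →
      CrossedAt γ l L0 j z ∧ linf (z - y) = childRatio b * Ln L0 (j + 1) := by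
    intro b j y
    by_cases hy : CrossedAt γ l L0 (j + 1) y
    · obtain ⟨z, hz⟩ := hy.exists_child hγ hL0 b
      exact ⟨z, fun _ => hz⟩
    · exact ⟨y, fun h => absurd h hy⟩
  choose child hchild using hchild
  have hcross : ∀ m : List Bool, m.length ≤ n →
      CrossedAt γ l L0 (n - m.length) (iterateChild child n x m) := by
    intro m
    induction m with
    | nil => exact fun _ => ⟨hx, h1, h2⟩
    | cons b m ih =>
      intro hm
      rw [List.length_cons] at hm ⊢
      have := ih (by omega)
      rw [show n - m.length = n - m.length - 1 + 1 by omega] at this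
      exact (hchild b _ _ this).1
  have hdist : ∀ (b : Bool) (m : List Bool), m.length < n →
      linf (iterateChild child n x (b :: m) - iterateChild child n x m) =
        childRatio b * Ln L0 (n - m.length) := by
    intro b m hm
    have := hcross m hm.le
    rw [show n - m.length = n - m.length - 1 + 1 by omega] at this ⊢
    exact (hchild b _ _ this).2
  refine ⟨fun m => iterateChild child n x m.1.reverse, ⟨rfl, fun m h => ?_, fun m h => ?_⟩,
    fun m h => ?_⟩
  · simpa using (hcross m.reverse (by simpa using h)).1
  · simpa [childRatio] using
      And.intro (hdist false m.reverse (by simpa using h)) (hdist true m.reverse (by simpa using h))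
  · simpa using (hcross m.reverse (by simpa using h)).2
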